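/- Let r : S × A → [0,1] be a bounded reward function, let P_⋆ and P̂ be two dynamics on the same layered state space, and consider the MDPs M = (S, A, P_⋆, r, s_0, H) and M̂ = (S, A, P̂, r, s_0, H). Then for any deterministic policy π : S → A, V^π_{M̂}(s_0) ≤ 3 · V^π_M(s_0) + 9H² · E_{π,P_⋆}[ Σ_{h=0}^{H−1} D_H²(P̂(·|s_h,a_h), P_⋆(·|s_h,a_h)) | s_0 ]. -/

import Mathlib

open scoped BigOperators Classical
open Finset

noncomputable section

/-- Squared Hellinger distance between two distributions on a finite set. -/
def hellingerSq {X : Type*} [Fintype X] (P Q : X → ℝ) : ℝ :=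
  ∑ x, (Real.sqrt (P x) - Real.sqrt (Q x)) ^ 2

variable {S : ℕ → Type} [∀ h, Fintype (S h)] {A : Type} [Fintype A]

/-- Value function of a deterministic policy in a layered MDP, defined by the backward
Bellman recursion: `val P r pol k h s` is the value with `k` steps to go, starting at
state `s` in layer `h`.  The layer-`h` value function of the horizon-`H` MDP is
`val P r pol (H - h) h`. -/
def val (P : ∀ h, S h → A → S (h + 1) → ℝ) (r : ∀ h, S h → A → ℝ)
    (pol : ∀ h, S h → A) : (k : ℕ) → (h : ℕ) → S h → ℝ
  | 0, _, _ => 0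
  | k + 1, h, s =>
      r h s (pol h s) + ∑ s' : S (h + 1), P h s (pol h s) s' * val P r pol k (h + 1) s'

/-- State-occupancy measure: `stateOcc P pol h0 st k s` is the probability of being at
state `s` in layer `h0 + k` when acting with the deterministic policy `pol` under
dynamics `P`, starting from state `st` in layer `h0`. -/
def stateOcc (P : ∀ h, S h → A → S (h + 1) → ℝ) (pol : ∀ h, S h → A)
    (h0 : ℕ) (st : S h0) : (k : ℕ) → S (h0 + k) → ℝ
  | 0, s => if s = st then 1 else 0
  | k + 1, s' =>
      ∑ s : S (h0 + k), stateOcc P pol h0 st k s * P (h0 + k) s (pol (h0 + k) s) s'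

/-- State-action occupancy measure started at `st` in layer `h0`. -/
def occ (P : ∀ h, S h → A → S (h + 1) → ℝ) (pol : ∀ h, S h → A)
    (h0 : ℕ) (st : S h0) (k : ℕ) (s : S (h0 + k)) (a : A) : ℝ :=
  if a = pol (h0 + k) s then stateOcc P pol h0 st k s else 0

/-- State-occupancy measure started from the initial state `s0` of layer `0`:
probability of being at state `s` in layer `h`. -/
def stateOcc0 (P : ∀ h, S h → A → S (h + 1) → ℝ) (pol : ∀ h, S h → A)
    (s0 : S 0) : (h : ℕ) → S h → ℝ
  | 0, s => if s = s0 then 1 else 0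
  | h + 1, s' => ∑ s : S h, stateOcc0 P pol s0 h s * P h s (pol h s) s'

/-- State-action occupancy measure `q_h(s, a | pol, P)` started from the initial state. -/
def occ0 (P : ∀ h, S h → A → S (h + 1) → ℝ) (pol : ∀ h, S h → A)
    (s0 : S 0) (h : ℕ) (s : S h) (a : A) : ℝ :=
  if a = pol h s then stateOcc0 P pol s0 h s else 0


theorem val_nonneg (P : ∀ h, S h → A → S (h + 1) → ℝ) (g : ∀ h, S h → A → ℝ)
    (pol : ∀ h, S h → A) (H : ℕ)
    (hP0 : ∀ h, h < H → ∀ s a s', 0 ≤ P h s a s')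
    (hg : ∀ h s a, 0 ≤ g h s a) (k h : ℕ) (hk : h + k ≤ H) (s : S h) :
    0 ≤ val P g pol k h s := by
  induction k generalizing h with
  | zero => simp [_root_.val]
  | succ k ih =>
    exact add_nonneg (hg _ _ _) (Finset.sum_nonneg fun s' _ =>
      mul_nonneg (hP0 h (by omega) _ _ _) (ih (h + 1) (by omega) s'))

theorem val_le (P : ∀ h, S h → A → S (h + 1) → ℝ) (r : ∀ h, S h → A → ℝ)
    (pol : ∀ h, S h → A) (H : ℕ)
    (hP0 : ∀ h, h < H → ∀ s a s', 0 ≤ P h s a s')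
    (hP1 : ∀ h, h < H → ∀ s a, (∑ s', P h s a s') = 1)
    (hr : ∀ h s a, 0 ≤ r h s a ∧ r h s a ≤ 1) (k h : ℕ) (hk : h + k ≤ H) (s : S h) :
    val P r pol k h s ≤ k := by
  induction k generalizing h with
  | zero => simp [_root_.val]
  | succ k ih =>
    have hh : h < H := by omega
    have ih' := ih (h + 1) (by omega)
    simp only [_root_.val]
    have hsum : ∑ s', P h s (pol h s) s' * val P r pol k (h + 1) s' ≤
        ∑ s', P h s (pol h s) s' * (k : ℝ) :=
      Finset.sum_le_sum fun s' _ => mul_le_mul_of_nonneg_left (ih' s') (hP0 h hh _ _ _)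
    rw [← Finset.sum_mul, hP1 h hh, one_mul] at hsum
    push_cast
    linarith [(hr h s (pol h s)).2]

/-- The value function is the occupancy-weighted sum of the rewards. -/
theorem sum_stateOcc0_mul_val (P : ∀ h, S h → A → S (h + 1) → ℝ) (g : ∀ h, S h → A → ℝ)
    (pol : ∀ h, S h → A) (s0 : S 0) (k h : ℕ) :
    ∑ s, stateOcc0 P pol s0 h s * val P g pol k h s =
      ∑ j ∈ Finset.range k, ∑ s, stateOcc0 P pol s0 (h + j) s * g (h + j) s (pol (h + j) s) := by
  induction k generalizing h with
  | zero => simp [_root_.val]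
  | succ k ih =>
    have hstep : ∑ s, stateOcc0 P pol s0 h s *
          ∑ s', P h s (pol h s) s' * val P g pol k (h + 1) s' =
        ∑ s', stateOcc0 P pol s0 (h + 1) s' * val P g pol k (h + 1) s' := by
      simp only [stateOcc0, Finset.mul_sum, Finset.sum_mul]
      rw [Finset.sum_comm]
      simp only [mul_assoc]
    let F : ℕ → ℝ := fun i => ∑ s, stateOcc0 P pol s0 i s * g i s (pol i s)
    have hF : ∑ j ∈ Finset.range k, F (h + 1 + j) = ∑ j ∈ Finset.range k, F (h + (j + 1)) :=
      Finset.sum_congr rfl fun j _ => congrArg F (by omega)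
    simp only [_root_.val, mul_add, Finset.sum_add_distrib]
    rw [hstep, ih, Finset.sum_range_succ']
    change F h + ∑ j ∈ Finset.range k, F (h + 1 + j) =
      ∑ j ∈ Finset.range k, F (h + (j + 1)) + F h
    rw [hF, add_comm]

theorem hellingerSq_nonneg {X : Type*} [Fintype X] (P Q : X → ℝ) : 0 ≤ hellingerSq P Q :=
  Finset.sum_nonneg fun _ _ => sq_nonneg _

/-- Change of measure for a function bounded by `B`, at the cost of a factor `1 + 1 / c`. -/
theorem sum_mul_le_add_hellingerSq {X : Type*} [Fintype X] (P Q f : X → ℝ) {B c : ℝ}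
    (hP : ∀ x, 0 ≤ P x) (hQ : ∀ x, 0 ≤ Q x) (hf0 : ∀ x, 0 ≤ f x) (hfB : ∀ x, f x ≤ B)
    (hc : 0 < c) :
    ∑ x, P x * f x ≤ (1 + 1 / c) * ∑ x, Q x * f x + B * (1 + c) * hellingerSq P Q := by
  unfold hellingerSq
  rw [Finset.mul_sum, Finset.mul_sum, ← Finset.sum_add_distrib]
  refine Finset.sum_le_sum fun x _ => ?_
  set u := Real.sqrt (P x)
  set v := Real.sqrt (Q x)
  have hu : P x = u ^ 2 := (Real.sq_sqrt (hP x)).symm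
  have hv : Q x = v ^ 2 := (Real.sq_sqrt (hQ x)).symm
  have hyoung : u ^ 2 ≤ (1 + 1 / c) * v ^ 2 + (1 + c) * (u - v) ^ 2 := by
    have hid : (1 + 1 / c) * v ^ 2 + (1 + c) * (u - v) ^ 2 - u ^ 2 =
        (v - c * (u - v)) ^ 2 / c := by
      field_simp
      ring
    have : 0 ≤ (v - c * (u - v)) ^ 2 / c := by positivity
    linarith
  have hB : (1 + c) * (u - v) ^ 2 * f x ≤ (1 + c) * (u - v) ^ 2 * B :=
    mul_le_mul_of_nonneg_left (hfB x) (by positivity)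
  have hmul := mul_le_mul_of_nonneg_right hyoung (hf0 x)
  rw [hu, hv]
  linarith

theorem val_le_pow_mul_val_add (H : ℕ) (hH : 1 ≤ H)
    (Pstar Phat : ∀ h, S h → A → S (h + 1) → ℝ)
    (hPstar0 : ∀ h, h < H → ∀ s a s', 0 ≤ Pstar h s a s')
    (hPhat0 : ∀ h, h < H → ∀ s a s', 0 ≤ Phat h s a s')
    (hPhat1 : ∀ h, h < H → ∀ s a, (∑ s', Phat h s a s') = 1)
    (r : ∀ h, S h → A → ℝ)
    (hr : ∀ h s a, 0 ≤ r h s a ∧ r h s a ≤ 1)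
    (pol : ∀ h, S h → A) (k h : ℕ) (hk : h + k ≤ H) (s : S h) :
    val Phat r pol k h s ≤
      (1 + 1 / (H : ℝ)) ^ k * (val Pstar r pol k h s + (H : ℝ) * (1 + H) *
        val Pstar (fun h s a => hellingerSq (Phat h s a) (Pstar h s a)) pol k h s) := by
  have hHpos : (0 : ℝ) < H := by exact_mod_cast hH
  induction k generalizing h with
  | zero => simp [_root_.val]
  | succ k ih =>
    have hh : h < H := by omega
    have hb := val_le Phat r pol H hPhat0 hPhat1 hr k (h + 1) (by omega)
    have hb0 := val_nonneg Phat r pol H hPhat0 (fun h s a => (hr h s a).1) k (h + 1) (by omega)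
    have hkH : (k : ℝ) ≤ H := by exact_mod_cast (by omega : k ≤ H)
    have hchange := sum_mul_le_add_hellingerSq (Phat h s (pol h s)) (Pstar h s (pol h s))
      (val Phat r pol k (h + 1)) (hPhat0 h hh _ _) (hPstar0 h hh _ _)
      hb0 (fun s' => (hb s').trans hkH) hHpos
    have hih := Finset.sum_le_sum fun s' (_ : s' ∈ Finset.univ) =>
      mul_le_mul_of_nonneg_left (ih (h + 1) (by omega) s') (hPstar0 h hh s (pol h s) s')
    set e : ∀ h, S h → A → ℝ := fun h s a => hellingerSq (Phat h s a) (Pstar h s a) with he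
    have hexpand : ∑ s', Pstar h s (pol h s) s' * ((1 + 1 / (H : ℝ)) ^ k *
          (val Pstar r pol k (h + 1) s' + (H : ℝ) * (1 + H) * val Pstar e pol k (h + 1) s')) =
        (1 + 1 / (H : ℝ)) ^ k * (∑ s', Pstar h s (pol h s) s' * val Pstar r pol k (h + 1) s' +
          (H : ℝ) * (1 + H) * ∑ s', Pstar h s (pol h s) s' * val Pstar e pol k (h + 1) s') := by
      rw [Finset.mul_sum, ← Finset.sum_add_distrib, Finset.mul_sum]
      exact Finset.sum_congr rfl fun _ _ => by ring
    rw [hexpand] at hih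
    have hη : (0 : ℝ) ≤ 1 + 1 / H := by positivity
    have hpow : (1 : ℝ) ≤ (1 + 1 / H) ^ (k + 1) :=
      one_le_pow₀ (by have : (0 : ℝ) ≤ 1 / H := by positivity
                      linarith)
    have hlocal : 0 ≤ r h s (pol h s) + (H : ℝ) * (1 + H) * e h s (pol h s) :=
      add_nonneg (hr _ _ _).1 (mul_nonneg (by positivity) (hellingerSq_nonneg _ _))
    have hscaled := le_mul_of_one_le_left hlocal hpow
    have hmul := mul_le_mul_of_nonneg_left hih hη
    rw [← mul_assoc, ← pow_succ'] at hmul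
    simp only [_root_.val]
    calc _ ≤ r h s (pol h s) + (H : ℝ) * (1 + H) * e h s (pol h s) +
          (1 + 1 / (H : ℝ)) ^ (k + 1) *
            (∑ s', Pstar h s (pol h s) s' * val Pstar r pol k (h + 1) s' +
          (H : ℝ) * (1 + H) * ∑ s', Pstar h s (pol h s) s' * val Pstar e pol k (h + 1) s') := by
          simp only [he] at hmul ⊢
          linarith
      _ ≤ _ := by linarith

theorem one_add_one_div_pow_le_three (n : ℕ) (hn : 1 ≤ n) : (1 + 1 / (n : ℝ)) ^ n ≤ 3 := by
  have hpos : (0 : ℝ) < n := by exact_mod_cast hn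
  calc (1 + 1 / (n : ℝ)) ^ n ≤ Real.exp (1 / (n : ℝ)) ^ n := by
        gcongr
        linarith [Real.add_one_le_exp (1 / (n : ℝ))]
    _ = Real.exp 1 := by
        rw [← Real.exp_nat_mul]
        congr 1
        field_simp
    _ ≤ 3 := by linarith [Real.exp_one_lt_d9]

/-- **Value change of measure** (Lemma 2.2 / `lemma:value-change-of-measure-main`):
for a reward in `[0,1]` and two dynamics `Pstar`, `Phat`,
`V^π_{M̂}(s₀) ≤ 3 V^π_M(s₀) + 9 H² E_{π,P⋆}[ Σ_{h<H} D_H²(P̂(·|s_h,a_h), P⋆(·|s_h,a_h)) ]`. -/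
theorem stmt4
    (H : ℕ) (hH : 1 ≤ H)
    (s0 : S 0) (hS0 : ∀ s : S 0, s = s0)
    (Pstar Phat : ∀ h, S h → A → S (h + 1) → ℝ)
    (hPstar0 : ∀ h, h < H → ∀ s a s', 0 ≤ Pstar h s a s')
    (hPstar1 : ∀ h, h < H → ∀ s a, (∑ s', Pstar h s a s') = 1)
    (hPhat0 : ∀ h, h < H → ∀ s a s', 0 ≤ Phat h s a s')
    (hPhat1 : ∀ h, h < H → ∀ s a, (∑ s', Phat h s a s') = 1)
    (r : ∀ h, S h → A → ℝ)
    (hr : ∀ h s a, 0 ≤ r h s a ∧ r h s a ≤ 1)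
    (pol : ∀ h, S h → A) :
    val Phat r pol H 0 s0 ≤
      3 * val Pstar r pol H 0 s0 +
        9 * (H : ℝ) ^ 2 *
          ∑ h ∈ Finset.range H, ∑ s : S h, ∑ a : A,
            occ0 Pstar pol s0 h s a * hellingerSq (Phat h s a) (Pstar h s a) := by
  set e : ∀ h, S h → A → ℝ := fun h s a => hellingerSq (Phat h s a) (Pstar h s a) with he
  have hmain := val_le_pow_mul_val_add H hH Pstar Phat hPstar0 hPhat0 hPhat1 r hr pol H 0
    (by omega) s0
  have hV := val_nonneg Pstar r pol H hPstar0 (fun h s a => (hr h s a).1) H 0 (by omega) s0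
  have hW := val_nonneg Pstar e pol H hPstar0 (fun _ _ _ => hellingerSq_nonneg _ _) H 0
    (by omega) s0
  have hocc : ∑ h ∈ Finset.range H, ∑ s : S h, ∑ a : A,
      occ0 Pstar pol s0 h s a * hellingerSq (Phat h s a) (Pstar h s a) =
        val Pstar e pol H 0 s0 := by
    have h := sum_stateOcc0_mul_val Pstar e pol s0 H 0
    simp only [stateOcc0, ite_mul, one_mul, zero_mul, Finset.sum_ite_eq',
      Finset.mem_univ, if_true] at h
    rw [h]
    let F : ℕ → ℝ := fun i => ∑ s, stateOcc0 Pstar pol s0 i s * e i s (pol i s)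
    change _ = ∑ j ∈ Finset.range H, F (0 + j)
    simp only [zero_add, F, occ0, ite_mul, zero_mul, Finset.sum_ite_eq',
      Finset.mem_univ, if_true, he]
  rw [hocc]
  have hH1 : (1 : ℝ) ≤ H := by exact_mod_cast hH
  have hcoef : 3 * ((H : ℝ) * (1 + H)) ≤ 9 * (H : ℝ) ^ 2 := by nlinarith
  have hthree := mul_le_mul_of_nonneg_right (one_add_one_div_pow_le_three H hH)
    (add_nonneg hV (mul_nonneg (by positivity : (0 : ℝ) ≤ (H : ℝ) * (1 + H)) hW))
  have hcoefW := mul_le_mul_of_nonneg_right hcoef hW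
  linarith

end
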